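/- Let 𝔖 = {S₁,…,Sₙ}, n ≥ 1, be a split system on a finite multiset 𝓜, and let G be a consistent thin subgraph of Γ(𝔖). If i,j,k ∈ {1,…,n} are such that ((Ā,Sᵢ),(B,Sⱼ)) and ((C̄,Sₖ),(B,Sⱼ)) are two distinct critical arcs of G (where A|Ā = Sᵢ, B|B̄ = Sⱼ, C|C̄ = Sₖ), then ((Ā,Sᵢ),(C,Sₖ)) is a critical arc of G. -/

import Mathlib

open scoped Classical

/-- A split of a multiset `M`: an unordered pair of nonempty submultisets of `M`
whose multiset union is `M`. -/
def IsSplit {X : Type} (M : Multiset X) (S : Sym2 (Multiset X)) : Prop :=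
  ∃ A B : Multiset X, S = s(A, B) ∧ A ≠ 0 ∧ B ≠ 0 ∧ A + B = M

/-- A split system on `M`: a multiset of splits of `M`. -/
def IsSplitSystem {X : Type} (M : Multiset X) (𝔖 : Multiset (Sym2 (Multiset X))) : Prop :=
  ∀ S ∈ 𝔖, IsSplit M S

/-- An `M`-tree: a finite tree whose vertices are labelled by submultisets of `M`
such that (M1) the multiset union of all labels is `M`, and (M2) every vertex of
degree 1 or 2 has a nonempty label. -/
structure MTree (X : Type) (M : Multiset X) where
  n : ℕ
  G : SimpleGraph (Fin n)
  connected : G.Connected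
  acyclic : G.IsAcyclic
  label : Fin n → Multiset X
  m1 : ∑ v, label v = M
  m2 : ∀ v, G.degree v = 1 ∨ G.degree v = 2 → label v ≠ 0

namespace MTree

variable {X : Type} {M : Multiset X}

/-- The part of the split induced by the edge `{u, v}` lying on the side of `u`:
the multiset union of the labels of the vertices in the connected component of `u`
after deleting the edge `{u, v}`. -/
noncomputable def part (T : MTree X M) (u v : Fin T.n) : Multiset X :=
  ∑ w ∈ Finset.univ.filter (fun w => (T.G.deleteEdges {s(u, v)}).Reachable u w), T.label w

/-- The multiset of splits represented by an `M`-tree: the splits induced by its edges. -/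
noncomputable def splits (T : MTree X M) : Multiset (Sym2 (Multiset X)) :=
  T.G.edgeFinset.val.map
    (Sym2.lift ⟨fun u v => s(T.part u v, T.part v u), fun u v => Sym2.eq_swap⟩)

end MTree

/-- A split system on `M` is compatible if some `M`-tree represents it. -/
def Compatible {X : Type} (M : Multiset X) (𝔖 : Multiset (Sym2 (Multiset X))) : Prop :=
  ∃ T : MTree X M, T.splits = 𝔖

/-- `Δ(M) = Σ_{x ∈ X} (M(x) - 1)`. -/
def delta {X : Type} [DecidableEq X] (M : Multiset X) : ℕ :=
  ∑ x ∈ M.toFinset, (M.count x - 1)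

/-- The split system `{S₁, …, Sₙ}` determined by an indexed family of ordered splits,
where split `i` has parts `P i true` and `P i false`. -/
def splitSystemOf {X : Type} {n : ℕ} (P : Fin n → Bool → Multiset X) :
    Multiset (Sym2 (Multiset X)) :=
  (Finset.univ.val : Multiset (Fin n)).map fun i => s(P i true, P i false)

/-- The arcs of the split-containment graph `Γ(𝔖)`: its vertices are the pairs
`(i, b)` (representing the pair `(P i b, Sᵢ)` of a part of the split `Sᵢ` together
with `Sᵢ`), and there is an arc from `(i, b)` to `(j, c)` iff `i ≠ j` and
`P i b ⊊ P j c` as multisets. -/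
def GammaArc {X : Type} {n : ℕ} (P : Fin n → Bool → Multiset X)
    (u v : Fin n × Bool) : Prop :=
  u.1 ≠ v.1 ∧ P u.1 u.2 < P v.1 v.2

/-- A thin subgraph of `Γ(𝔖)`: a spanning subgraph `G` of `Γ(𝔖)` such that for all
distinct `i, j` the restriction of `G` to the four vertices coming from `Sᵢ` and `Sⱼ`
has exactly two arcs, of the form `((C,Sᵢ),(D,Sⱼ))` and `((D̄,Sⱼ),(C̄,Sᵢ))`. -/
def IsThinSubgraph {X : Type} {n : ℕ} (P : Fin n → Bool → Multiset X)
    (G : Fin n × Bool → Fin n × Bool → Prop) : Prop :=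
  (∀ u v, G u v → GammaArc P u v) ∧
  ∀ i j : Fin n, i ≠ j → ∃ b c : Bool, ∀ b' c' : Bool,
    (G (i, b') (j, c') ↔ b' = b ∧ c' = c) ∧
    (G (j, c') (i, b') ↔ c' = !c ∧ b' = !b)

/-- An arc `(u, v)` of a digraph `G` is critical if the only directed path in `G`
from `u` to `v` is the arc itself. -/
def IsCriticalArc {V : Type} (G : V → V → Prop) (u v : V) : Prop :=
  G u v ∧ ¬ ∃ w, G u w ∧ w ≠ v ∧ Relation.TransGen G w v

/-- A (thin) subgraph `G` of `Γ(𝔖)` is consistent if for every vertex `(A, Sᵢ)` of `G`,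
the multiset union of the parts `B` over all vertices `(B, Sⱼ)` such that
`((B,Sⱼ),(A,Sᵢ))` is a critical arc of `G` is a submultiset of `A`. -/
def IsConsistent {X : Type} {n : ℕ} (P : Fin n → Bool → Multiset X)
    (G : Fin n × Bool → Fin n × Bool → Prop) : Prop :=
  ∀ u : Fin n × Bool,
    (∑ w ∈ Finset.univ.filter (fun w => IsCriticalArc G w u), P w.1 w.2) ≤ P u.1 u.2

/-- A part `A` of a split `A|Ā ∈ 𝔖` is a terminal set of `𝔖` if for every split
`B|B̄` of `𝔖` other than (this occurrence of) `A|Ā`, neither `B ⊊ A` nor `B̄ ⊊ A`. -/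
def IsTerminal {X : Type} [DecidableEq X] (M : Multiset X)
    (𝔖 : Multiset (Sym2 (Multiset X))) (A : Multiset X) : Prop :=
  s(A, M - A) ∈ 𝔖 ∧ ∀ T ∈ 𝔖.erase s(A, M - A), ∀ B ∈ T, ¬ B < A

/-- A terminal set `A` of `𝔖` is a superterminal set if in addition, for every split
`B|B̄` of `𝔖` other than `A|Ā`, exactly one of `A ⊊ B`, `A ⊊ B̄` holds. -/
def IsSuperterminal {X : Type} [DecidableEq X] (M : Multiset X)
    (𝔖 : Multiset (Sym2 (Multiset X))) (A : Multiset X) : Prop :=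
  IsTerminal M 𝔖 A ∧
    ∀ T ∈ 𝔖.erase s(A, M - A), ∀ B C : Multiset X, T = s(B, C) → (A < B ↔ ¬ A < C)

/-- Two splits are compatible if they have parts `A ∈ S₁`, `B ∈ S₂` with `A ∩ B = ∅`
(multiset intersection). -/
def SplitPairCompatible {X : Type} [DecidableEq X] (S₁ S₂ : Sym2 (Multiset X)) : Prop :=
  ∃ A ∈ S₁, ∃ B ∈ S₂, A ∩ B = 0

/-- A split system is pairwise compatible if any two of its splits are compatible. -/
def PairwiseCompatible {X : Type} [DecidableEq X] (𝔖 : Multiset (Sym2 (Multiset X))) : Prop :=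
  ∀ S₁ ∈ 𝔖, ∀ S₂ ∈ 𝔖.erase S₁, SplitPairCompatible S₁ S₂

/-- The size of a split `A|B` is `min {|A|, |B|}`. -/
def splitSize {X : Type} : Sym2 (Multiset X) → ℕ :=
  Sym2.lift ⟨fun A B => min A.card B.card, fun A B => min_comm _ _⟩

/-- Isomorphism of `M`-trees: a graph isomorphism preserving the labels. -/
def MTreeIso {X : Type} {M : Multiset X} (T T' : MTree X M) : Prop :=
  ∃ φ : Fin T.n ≃ Fin T'.n,
    (∀ u v, T.G.Adj u v ↔ T'.G.Adj (φ u) (φ v)) ∧ ∀ v, T'.label (φ v) = T.label v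

/-- Isomorphism of digraphs. -/
def DigraphIso {V W : Type} (R : V → V → Prop) (Q : W → W → Prop) : Prop :=
  ∃ φ : V ≃ W, ∀ a b, R a b ↔ Q (φ a) (φ b)

/-- The digraph `D₁` on the four vertices `v = 0`, `w = 1`, `p = 2`, `q = 3`,
with arcs `(v,p)` and `(q,w)`. -/
def D1 : Fin 4 → Fin 4 → Prop := fun a b => (a = 0 ∧ b = 2) ∨ (a = 3 ∧ b = 1)

/-- The digraph `D₂` on the four vertices `v = 0`, `w = 1`, `p = 2`, `q = 3`,
with arcs `(v,p)`, `(p,w)`, `(v,q)` and `(q,w)`. -/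
def D2 : Fin 4 → Fin 4 → Prop :=
  fun a b => (a = 0 ∧ b = 2) ∨ (a = 2 ∧ b = 1) ∨ (a = 0 ∧ b = 3) ∨ (a = 3 ∧ b = 1)

/-- Isomorphism of subgraphs of `Γ(𝔖)`: a digraph isomorphism mapping each vertex
`(A, Sᵢ)` to a vertex `(B, Sⱼ)` with `A = B`. -/
def SubgraphIso {X : Type} {n : ℕ} (P : Fin n → Bool → Multiset X)
    (G G' : Fin n × Bool → Fin n × Bool → Prop) : Prop :=
  ∃ φ : Fin n × Bool ≃ Fin n × Bool,
    (∀ u v, G u v ↔ G' (φ u) (φ v)) ∧ ∀ u, P (φ u).1 (φ u).2 = P u.1 u.2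

/-- The vertex `(Ā, Sᵢ)` belonging to the vertex `(A, Sᵢ)`. -/
def coVertex {n : ℕ} (u : Fin n × Bool) : Fin n × Bool := (u.1, !u.2)

@[simp] lemma coVertex_coVertex {n : ℕ} (u : Fin n × Bool) : coVertex (coVertex u) = u := by
  simp [coVertex]

lemma eq_or_eq_coVertex {n : ℕ} {u v : Fin n × Bool} (h : u.1 = v.1) :
    u = v ∨ u = coVertex v := by
  obtain ⟨i, b⟩ := u
  obtain ⟨j, c⟩ := v
  obtain rfl : i = j := h
  cases b <;> cases c <;> simp [coVertex]

lemma card_add_card_coVertex {X : Type} {n : ℕ} {M : Multiset X} {P : Fin n → Bool → Multiset X}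
    (hsum : ∀ i, P i true + P i false = M) (u : Fin n × Bool) :
    (P u.1 u.2).card + (P (coVertex u).1 (coVertex u).2).card = M.card := by
  obtain ⟨i, b⟩ := u
  rw [← hsum i, Multiset.card_add]
  cases b <;> simp [coVertex, add_comm]

namespace IsThinSubgraph

variable {X : Type} {n : ℕ} {P : Fin n → Bool → Multiset X}
  {G : Fin n × Bool → Fin n × Bool → Prop} {u v w : Fin n × Bool}

lemma fst_ne (h : IsThinSubgraph P G) (huv : G u v) : u.1 ≠ v.1 := (h.1 u v huv).1

lemma card_lt (h : IsThinSubgraph P G) (huv : Relation.TransGen G u v) :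
    (P u.1 u.2).card < (P v.1 v.2).card := by
  induction huv with
  | single e => exact Multiset.card_lt_card (h.1 _ _ e).2
  | tail _ e ih => exact ih.trans (Multiset.card_lt_card (h.1 _ _ e).2)

lemma card_le (h : IsThinSubgraph P G) (huv : Relation.ReflTransGen G u v) :
    (P u.1 u.2).card ≤ (P v.1 v.2).card := by
  rcases Relation.reflTransGen_iff_eq_or_transGen.1 huv with rfl | e
  · exact le_rfl
  · exact (h.card_lt e).le

lemma not_transGen_self (h : IsThinSubgraph P G) : ¬ Relation.TransGen G u u :=
  fun e => (h.card_lt e).false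

lemma dual (h : IsThinSubgraph P G) (huv : G u v) : G (coVertex v) (coVertex u) := by
  obtain ⟨b, c, hbc⟩ := h.2 u.1 v.1 (h.fst_ne huv)
  have e := (hbc u.2 v.2).1.1 huv
  exact (hbc (!u.2) (!v.2)).2.2 (by simp [e])

lemma dual_reflTransGen (h : IsThinSubgraph P G) (huv : Relation.ReflTransGen G u v) :
    Relation.ReflTransGen G (coVertex v) (coVertex u) := by
  induction huv with
  | refl => exact .refl
  | tail _ e ih => exact ih.head (h.dual e)

lemma not_coVertex_right (h : IsThinSubgraph P G) (huv : G u v) : ¬ G u (coVertex v) := by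
  obtain ⟨b, c, hbc⟩ := h.2 u.1 v.1 (h.fst_ne huv)
  intro e
  have h1 := (hbc u.2 v.2).1.1 huv
  have h2 := (hbc u.2 (!v.2)).1.1 e
  simp [h1] at h2

lemma not_coVertex_left (h : IsThinSubgraph P G) (huv : G u v) : ¬ G (coVertex u) v :=
  fun e => h.not_coVertex_right (h.dual huv) (h.dual e)

lemma total (h : IsThinSubgraph P G) (hne : u.1 ≠ v.1) :
    G u v ∨ G v u ∨ G u (coVertex v) ∨ G (coVertex u) v := by
  obtain ⟨i, b'⟩ := u
  obtain ⟨j, c'⟩ := v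
  obtain ⟨b, c, hbc⟩ := h.2 i j hne
  simp only [coVertex, hbc]
  cases b <;> cases c <;> cases b' <;> cases c' <;> simp

/-- If `u → v`, then some vertex reachable from `u` has a critical arc into `v`. -/
lemma exists_isCriticalArc (h : IsThinSubgraph P G) (huv : G u v) :
    ∃ z, Relation.ReflTransGen G u z ∧ IsCriticalArc G z v := by
  induction hm : (P v.1 v.2).card - (P u.1 u.2).card using Nat.strong_induction_on
    generalizing u with
  | _ m ih =>
    by_cases hc : IsCriticalArc G u v
    · exact ⟨u, .refl, hc⟩
    · obtain ⟨y, huy, -, hyv⟩ : ∃ y, G u y ∧ y ≠ v ∧ Relation.TransGen G y v := by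
        by_contra hy
        exact hc ⟨huv, hy⟩
      obtain ⟨x, hyx, hxv⟩ := Relation.TransGen.tail'_iff.1 hyv
      have hux : Relation.TransGen G u x := .head' huy hyx
      have := h.card_lt hux
      have := h.card_lt (.single hxv)
      obtain ⟨z, hxz, hz⟩ := ih _ (by omega) hxv rfl
      exact ⟨z, hux.to_reflTransGen.trans hxz, hz⟩

/-- If `b → c → w` and `b̄ → w` never hold together, then `w` is not reachable from `w̄`. -/
lemma not_transGen_coVertex (h : IsThinSubgraph P G)
    (hw : ∀ b c, G b c → G c w → ¬ G (coVertex b) w) :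
    ¬ Relation.TransGen G (coVertex w) w := by
  have key : ∀ y, Relation.TransGen G y w → ¬ G (coVertex w) y := by
    intro y hy
    induction hy using Relation.TransGen.head_induction_on with
    | single e => exact fun e' => h.not_coVertex_left e (by simpa using h.dual e')
    | @head y x hyx hxw ih =>
      intro e
      have e' : G (coVertex y) w := by simpa using h.dual e
      have hne : x.1 ≠ w.1 := by
        intro hxw1
        rcases eq_or_eq_coVertex hxw1 with rfl | rfl
        · exact h.not_transGen_self hxw
        · exact h.not_transGen_self (.head e (.single hyx))
      rcases h.total hne with e₁ | e₁ | e₁ | e₁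
      · exact hw y x hyx e₁ e'
      · exact h.not_transGen_self (hxw.head e₁)
      · exact h.not_transGen_self (.head e (.head hyx (.single e₁)))
      · exact ih (by simpa using h.dual e₁)
  intro hww
  obtain ⟨y, hy, hyw⟩ := Relation.TransGen.head'_iff.1 hww
  rcases Relation.reflTransGen_iff_eq_or_transGen.1 hyw with rfl | hyw
  · exact h.fst_ne hy rfl
  · exact key y hyw hy

end IsThinSubgraph

lemma IsConsistent.add_le {X : Type} {n : ℕ} {P : Fin n → Bool → Multiset X}
    {G : Fin n × Bool → Fin n × Bool → Prop} (hcons : IsConsistent P G) {u w v : Fin n × Bool}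
    (hu : IsCriticalArc G u v) (hw : IsCriticalArc G w v) (hne : u ≠ w) :
    P u.1 u.2 + P w.1 w.2 ≤ P v.1 v.2 := by
  rw [← Finset.sum_pair (f := fun w : Fin n × Bool => P w.1 w.2) hne]
  refine le_trans (Finset.sum_le_sum_of_subset ?_) (hcons v)
  intro x hx
  rcases Finset.mem_insert.1 hx with rfl | hx
  · simpa using hu
  · simpa [Finset.mem_singleton.1 hx] using hw

namespace IsThinSubgraph

variable {X : Type} {M : Multiset X} {n : ℕ} {P : Fin n → Bool → Multiset X}
  {G : Fin n × Bool → Fin n × Bool → Prop}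

lemma not_coVertex_of_consistent (h : IsThinSubgraph P G) (hcons : IsConsistent P G)
    (hsum : ∀ i, P i true + P i false = M) {b c t : Fin n × Bool}
    (hbc : G b c) (hct : G c t) : ¬ G (coVertex b) t := by
  induction hm : (P t.1 t.2).card using Nat.strong_induction_on generalizing b c t with
  | _ m ih =>
    intro hbt
    obtain ⟨z, hcz, hz⟩ := h.exists_isCriticalArc hct
    obtain ⟨z', hbz, hz'⟩ := h.exists_isCriticalArc hbt
    by_cases hzz : z = z'
    · subst hzz
      have hlt := h.card_lt (.single hz.1)
      refine h.not_transGen_coVertex (w := z)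
        (fun _ _ hb hc => ih _ (by omega) hb hc rfl) ?_
      have hzb : Relation.ReflTransGen G (coVertex z) b := by
        simpa using h.dual_reflTransGen hbz
      exact .trans_right hzb (.head' hbc hcz)
    · have hle := Multiset.card_le_card (hcons.add_le hz hz' hzz)
      rw [Multiset.card_add] at hle
      have := h.card_le hcz
      have := h.card_le hbz
      have := h.card_lt (.single hbc)
      have := card_add_card_coVertex hsum b
      have := card_add_card_coVertex hsum t
      omega

/-- A consistent thin subgraph is transitive. -/
lemma trans_of_consistent (h : IsThinSubgraph P G) (hcons : IsConsistent P G)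
    (hsum : ∀ i, P i true + P i false = M) {u v w : Fin n × Bool}
    (huv : G u v) (hvw : G v w) : G u w := by
  have hne : u.1 ≠ w.1 := by
    intro huw
    rcases eq_or_eq_coVertex huw with rfl | rfl
    · exact h.not_transGen_self (.head huv (.single hvw))
    · exact h.not_coVertex_left hvw (by simpa using h.dual huv)
  rcases h.total hne with e | e | e | e
  · exact e
  · exact (h.not_transGen_self (.head huv (.head hvw (.single e)))).elim
  · exact (h.not_coVertex_of_consistent hcons hsum hvw (by simpa using h.dual e)
      (h.dual huv)).elim
  · exact (h.not_coVertex_of_consistent hcons hsum huv hvw e).elim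

/-- Distinct critical arcs `u → v` and `w → v` force the critical arc `u → w̄`. -/
lemma isCriticalArc_coVertex (h : IsThinSubgraph P G) (hcons : IsConsistent P G)
    (hne : ∀ i b, P i b ≠ 0) (hsum : ∀ i, P i true + P i false = M) {u v w : Fin n × Bool}
    (hu : IsCriticalArc G u v) (hw : IsCriticalArc G w v) (huw : u ≠ w) :
    IsCriticalArc G u (coVertex w) := by
  have collapse : ∀ {x y}, Relation.TransGen G x y → G x y := by
    intro x y hxy
    induction hxy with
    | single e => exact e
    | tail _ e ih => exact h.trans_of_consistent hcons hsum ih e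
  have no_between : ∀ {a x}, IsCriticalArc G a v → G a x → ¬ G x v := by
    intro a x ha hax hxv
    refine ha.2 ⟨x, hax, ?_, .single hxv⟩
    rintro rfl
    exact h.fst_ne hxv rfl
  have hle := Multiset.card_le_card (hcons.add_le hu hw huw)
  rw [Multiset.card_add] at hle
  have hcu := card_add_card_coVertex hsum u
  have hcv := card_add_card_coVertex hsum v
  have hpos := Multiset.card_pos.2 (hne (coVertex v).1 (coVertex v).2)
  have huw1 : u.1 ≠ w.1 := by
    intro e
    rcases eq_or_eq_coVertex e.symm with rfl | rfl
    · exact huw rfl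
    · omega
  have arc : G u (coVertex w) := by
    rcases h.total huw1 with e | e | e | e
    · exact (no_between hu e hw.1).elim
    · exact (no_between hw e hu.1).elim
    · exact e
    · have := h.card_lt (.single e)
      omega
  refine ⟨arc, ?_⟩
  rintro ⟨x, hux, -, hxw⟩
  have hxw := collapse hxw
  have not_vw : ¬ G v (coVertex w) := fun e =>
    h.not_coVertex_left e (h.dual hw.1)
  have not_uv : ¬ G u (coVertex v) := h.not_coVertex_right hu.1
  have hxv : x.1 ≠ v.1 := by
    intro e
    rcases eq_or_eq_coVertex e with rfl | rfl
    · exact not_vw hxw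
    · exact not_uv hux
  rcases h.total hxv with e | e | e | e
  · exact no_between hu hux e
  · exact not_vw (h.trans_of_consistent hcons hsum e hxw)
  · exact not_uv (h.trans_of_consistent hcons hsum hux e)
  · exact no_between hw (by simpa using h.dual hxw) e

end IsThinSubgraph

/-- Lemma: forced critical arcs. Let `𝔖 = {S₁, …, Sₙ}`, `n ≥ 1`,
be a split system on `M` and let `G` be a consistent thin subgraph of `Γ(𝔖)`.
Writing `A = P i b`, `B = P j c`, `C = P k d` (so `Ā = P i (!b)`, `C̄ = P k (!d)`),
if `((Ā,Sᵢ),(B,Sⱼ))` and `((C̄,Sₖ),(B,Sⱼ))` are two distinct critical arcs of `G`,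
then `((Ā,Sᵢ),(C,Sₖ))` is a critical arc of `G`. -/
theorem stmt2 {X : Type} [DecidableEq X] (M : Multiset X) {n : ℕ} (hn : 1 ≤ n)
    (P : Fin n → Bool → Multiset X)
    (hne : ∀ i b, P i b ≠ 0) (hsum : ∀ i, P i true + P i false = M)
    (G : Fin n × Bool → Fin n × Bool → Prop)
    (hthin : IsThinSubgraph P G) (hcons : IsConsistent P G)
    (i j k : Fin n) (b c d : Bool)
    (h1 : IsCriticalArc G (i, !b) (j, c))
    (h2 : IsCriticalArc G (k, !d) (j, c))
    (hdist : (i, !b) ≠ ((k, !d) : Fin n × Bool)) :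
    IsCriticalArc G (i, !b) (k, d) := by
  simpa [coVertex] using hthin.isCriticalArc_coVertex hcons hne hsum h1 h2 hdist
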